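/- arXiv:1605.03776 — 4 statements merged into one kernel-verified Lean document; each statement's English description precedes it below -/
import Mathlib

section
/- Let Ω ⊂ ℝ⁴ be a bounded open set and K ⊆ Ω a compact subset. Then there exist constants C > 0 and δ₀ ∈ (0,1) such that for every δ ∈ (0, δ₀) and every ξ ∈ K one has | ∫_Ω U_{δ,ξ}(x)² dx − 16π² δ² |ln δ| | ≤ C δ². (Here 16π² = c₄² ω₃ with c₄ = 2√2 and ω₃ = 2π² the measure of the unit sphere S³ ⊂ ℝ⁴.) -/
open MeasureTheory Real

/-- The standard bubble `U_{δ,ξ}(x) = 2√2 · δ/(δ² + ‖x − ξ‖²)` on `ℝ⁴`. -/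
noncomputable def bubble (δ : ℝ) (ξ x : EuclideanSpace ℝ (Fin 4)) : ℝ :=
  2 * Real.sqrt 2 * δ / (δ ^ 2 + ‖x - ξ‖ ^ 2)

theorem hasDerivAt_bubble_radial_primitive {δ : ℝ} (hδ : 0 < δ) (y : ℝ) :
    HasDerivAt (fun y : ℝ => (Real.log (δ ^ 2 + y ^ 2) + δ ^ 2 / (δ ^ 2 + y ^ 2)) / 2)
      (y ^ 3 / (δ ^ 2 + y ^ 2) ^ 2) y := by
  have hpos : 0 < δ ^ 2 + y ^ 2 := by positivity
  have h : HasDerivAt (fun y : ℝ => δ ^ 2 + y ^ 2) (2 * y) y := by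
    simpa using (hasDerivAt_pow 2 y).const_add (δ ^ 2)
  refine (((h.log hpos.ne').add ((hasDerivAt_const y (δ ^ 2)).div h hpos.ne')).div_const
    2).congr_deriv ?_
  field_simp
  ring

theorem integral_bubble_radial {δ : ℝ} (hδ : 0 < δ) (R : ℝ) :
    ∫ y in (0 : ℝ)..R, y ^ 3 / (δ ^ 2 + y ^ 2) ^ 2 =
      (Real.log (δ ^ 2 + R ^ 2) + δ ^ 2 / (δ ^ 2 + R ^ 2) - 2 * Real.log δ - 1) / 2 := by
  have hpos : ∀ y : ℝ, (δ ^ 2 + y ^ 2) ^ 2 ≠ 0 := fun y => by positivity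
  rw [intervalIntegral.integral_eq_sub_of_hasDerivAt
    (fun y _ => hasDerivAt_bubble_radial_primitive hδ y)
    (Continuous.intervalIntegrable (by fun_prop (disch := exact hpos _)) _ _)]
  have : δ ^ 2 / δ ^ 2 = 1 := div_self (by positivity)
  simp [this]
  ring

theorem continuous_bubble {δ : ℝ} (hδ : 0 < δ) (ξ : EuclideanSpace ℝ (Fin 4)) :
    Continuous (bubble δ ξ) := by
  have hpos : ∀ x, δ ^ 2 + ‖x - ξ‖ ^ 2 ≠ 0 := fun x => by positivity
  unfold bubble
  fun_prop (disch := exact hpos _)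

theorem integral_ball_bubble_sq {δ R : ℝ} (hδ : 0 < δ) (hR : 0 < R)
    (ξ : EuclideanSpace ℝ (Fin 4)) :
    ∫ x in Metric.ball ξ R, (bubble δ ξ x) ^ 2 =
      8 * π ^ 2 * δ ^ 2 *
        (Real.log (δ ^ 2 + R ^ 2) + δ ^ 2 / (δ ^ 2 + R ^ 2) - 2 * Real.log δ - 1) := by
  let f : ℝ → ℝ := (Set.Iio R).indicator fun y => 8 * δ ^ 2 / (δ ^ 2 + y ^ 2) ^ 2
  have hf : ∀ x, (Metric.ball ξ R).indicator (fun x => (bubble δ ξ x) ^ 2) x = f ‖x - ξ‖ := by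
    intro x
    have h8 : (2 * √2) ^ 2 = 8 := by
      rw [mul_pow, Real.sq_sqrt (by norm_num)]; norm_num
    simp only [f, Set.indicator, Metric.mem_ball, Set.mem_Iio, dist_eq_norm, bubble, div_pow,
      mul_pow _ δ, h8]
  have hvol : volume.real (Metric.ball (0 : EuclideanSpace ℝ (Fin 4)) 1) = π ^ 2 / 2 := by
    rw [Measure.real,
      InnerProductSpace.volume_ball_of_dim_even (k := 2) (by simp)]
    simp [Nat.factorial]
    positivity
  have hrad : ∫ y in Set.Ioi (0 : ℝ), y ^ 3 • f y =
      8 * δ ^ 2 * ∫ y in (0 : ℝ)..R, y ^ 3 / (δ ^ 2 + y ^ 2) ^ 2 := by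
    have h : ∀ y, y ^ 3 • f y =
        (Set.Iio R).indicator (fun y => 8 * δ ^ 2 * (y ^ 3 / (δ ^ 2 + y ^ 2) ^ 2)) y := by
      intro y
      by_cases hy : y < R
      · simp [f, hy]; ring
      · simp [f, hy]
    simp_rw [h]
    rw [setIntegral_indicator measurableSet_Iio, Set.Ioi_inter_Iio, ← integral_Ioc_eq_integral_Ioo,
      ← intervalIntegral.integral_of_le hR.le, intervalIntegral.integral_const_mul]
  rw [← integral_indicator Metric.isOpen_ball.measurableSet]
  simp_rw [hf]
  rw [integral_sub_right_eq_self (fun x => f ‖x‖) ξ, integral_fun_norm_addHaar, hvol]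
  simp only [finrank_euclideanSpace, Fintype.card_fin]
  norm_num only [Nat.reduceSub]
  rw [hrad, integral_bubble_radial hδ R]
  simp
  ring

theorem bubble_L2_log_expansion (Ω : Set (EuclideanSpace ℝ (Fin 4)))
    (hΩo : IsOpen Ω) (hΩb : Bornology.IsBounded Ω)
    (K : Set (EuclideanSpace ℝ (Fin 4))) (hK : IsCompact K) (hKΩ : K ⊆ Ω) :
    ∃ C > (0 : ℝ), ∃ δ₀ : ℝ, 0 < δ₀ ∧ δ₀ < 1 ∧ ∀ δ : ℝ, 0 < δ → δ < δ₀ → ∀ ξ ∈ K,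
      abs ((∫ x in Ω, (bubble δ ξ x) ^ 2) - 16 * π ^ 2 * δ ^ 2 * |Real.log δ|) ≤ C * δ ^ 2 := by
  obtain ⟨r, hr, hrΩ⟩ := hK.exists_thickening_subset_open hΩo hKΩ
  set R : ℝ := Metric.diam Ω + 1 with hRdef
  have hR : 0 < R := by positivity
  refine ⟨8 * π ^ 2 * (|Real.log (r ^ 2)| + |Real.log (1 + R ^ 2)| + 1), by positivity,
    1 / 2, by norm_num, by norm_num, fun δ hδ hδ' ξ hξ => ?_⟩
  have hsub : Metric.ball ξ r ⊆ Ω := fun x hx =>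
    hrΩ (Metric.mem_thickening_iff.2 ⟨ξ, hξ, hx⟩)
  have hsup : Ω ⊆ Metric.ball ξ R := fun x hx => by
    have := Metric.dist_le_diam_of_mem hΩb hx (hKΩ hξ)
    rw [Metric.mem_ball]
    linarith
  have hint : IntegrableOn (fun x => (bubble δ ξ x) ^ 2) (Metric.ball ξ R) :=
    (((continuous_bubble hδ ξ).pow 2).continuousOn.integrableOn_compact
      (isCompact_closedBall ξ R)).mono_set Metric.ball_subset_closedBall
  have hlow := setIntegral_mono_set (hint.mono_set hsup)
    (Filter.Eventually.of_forall fun x => sq_nonneg (bubble δ ξ x)) hsub.eventuallyLE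
  have hupp := setIntegral_mono_set hint
    (Filter.Eventually.of_forall fun x => sq_nonneg (bubble δ ξ x)) hsup.eventuallyLE
  rw [integral_ball_bubble_sq hδ hr] at hlow
  rw [integral_ball_bubble_sq hδ hR] at hupp
  rw [abs_of_nonpos (Real.log_nonpos hδ.le (by linarith))]
  have hlogr : Real.log (r ^ 2) ≤ Real.log (δ ^ 2 + r ^ 2) :=
    Real.log_le_log (by positivity) (by nlinarith)
  have hlogR : Real.log (δ ^ 2 + R ^ 2) ≤ Real.log (1 + R ^ 2) :=
    Real.log_le_log (by positivity) (by nlinarith)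
  have hqr : 0 ≤ δ ^ 2 / (δ ^ 2 + r ^ 2) := by positivity
  have hqR : δ ^ 2 / (δ ^ 2 + R ^ 2) ≤ 1 := div_le_one_of_le₀ (by nlinarith) (by positivity)
  have hc : 0 ≤ 8 * π ^ 2 * δ ^ 2 := by positivity
  have hr_abs := neg_abs_le (Real.log (r ^ 2))
  have hR_abs := le_abs_self (Real.log (1 + R ^ 2))
  have hl := mul_le_mul_of_nonneg_left (a := 8 * π ^ 2 * δ ^ 2)
    (b := -(|Real.log (r ^ 2)| + |Real.log (1 + R ^ 2)| + 1))
    (c := Real.log (δ ^ 2 + r ^ 2) + δ ^ 2 / (δ ^ 2 + r ^ 2) - 1)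
    (by linarith [abs_nonneg (Real.log (1 + R ^ 2))]) hc
  have hu := mul_le_mul_of_nonneg_left (a := 8 * π ^ 2 * δ ^ 2)
    (b := Real.log (δ ^ 2 + R ^ 2) + δ ^ 2 / (δ ^ 2 + R ^ 2) - 1)
    (c := |Real.log (r ^ 2)| + |Real.log (1 + R ^ 2)| + 1)
    (by linarith [abs_nonneg (Real.log (r ^ 2))]) hc
  rw [abs_le]
  constructor <;> linarith
end

section
/- Let Ω ⊂ ℝ⁴ be a bounded open set, p, q > 0 and η > 0 small. Then there exist constants C > 0 and δ₀ > 0 such that for all δ₁, δ₂ ∈ (0, δ₀) and all ξ₁, ξ₂ ∈ Ω such that |ξ₁ − ξ₂| ≥ 2η and dist(ξ₁, ∂Ω) ≥ 2η, dist(ξ₂, ∂Ω) ≥ 2η, one has ∫_Ω U_{δ₁,ξ₁}(x)^p U_{δ₂,ξ₂}(x)^q dx ≤ C ( δ₂^q ∫_Ω U_{δ₁,ξ₁}(x)^p dx + δ₁^p ∫_Ω U_{δ₂,ξ₂}(x)^q dx + δ₁^p δ₂^q ). -/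
open MeasureTheory Real

theorem bubble_nonneg {δ : ℝ} (hδ : 0 ≤ δ) (ξ x : EuclideanSpace ℝ (Fin 4)) :
    0 ≤ bubble δ ξ x := by
  unfold bubble
  positivity

theorem continuous_bubble_rpow {δ p : ℝ} (hδ : 0 < δ) (hp : 0 ≤ p)
    (ξ : EuclideanSpace ℝ (Fin 4)) : Continuous fun x => bubble δ ξ x ^ p := by
  refine Continuous.rpow_const ?_ fun _ => Or.inr hp
  unfold bubble
  exact continuous_const.div (by fun_prop) fun x => by positivity

/-- Away from its centre, a bubble is of order `δ`. -/
theorem bubble_rpow_le {δ p η : ℝ} (hδ : 0 < δ) (hp : 0 ≤ p) (hη : 0 < η)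
    {ξ x : EuclideanSpace ℝ (Fin 4)} (hx : η ≤ ‖x - ξ‖) :
    bubble δ ξ x ^ p ≤ (2 * √2 / η ^ 2) ^ p * δ ^ p := by
  rw [← mul_rpow (by positivity) hδ.le]
  refine rpow_le_rpow (bubble_nonneg hδ.le ξ x) ?_ hp
  have hsq : η ^ 2 ≤ δ ^ 2 + ‖x - ξ‖ ^ 2 := by nlinarith [sq_nonneg δ]
  calc bubble δ ξ x ≤ 2 * √2 * δ / η ^ 2 :=
        div_le_div_of_nonneg_left (by positivity) (by positivity) hsq
    _ = 2 * √2 / η ^ 2 * δ := by ring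

/-- Bubbles with separated centres: at every point at least one of them is small. -/
theorem bubble_rpow_mul_bubble_rpow_le {δ₁ δ₂ p q η : ℝ} (hδ₁ : 0 < δ₁) (hδ₂ : 0 < δ₂)
    (hp : 0 ≤ p) (hq : 0 ≤ q) (hη : 0 < η) {ξ₁ ξ₂ : EuclideanSpace ℝ (Fin 4)}
    (hξ : 2 * η ≤ ‖ξ₁ - ξ₂‖) (x : EuclideanSpace ℝ (Fin 4)) :
    bubble δ₁ ξ₁ x ^ p * bubble δ₂ ξ₂ x ^ q ≤
      (2 * √2 / η ^ 2) ^ q * δ₂ ^ q * bubble δ₁ ξ₁ x ^ p +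
        (2 * √2 / η ^ 2) ^ p * δ₁ ^ p * bubble δ₂ ξ₂ x ^ q := by
  have h₁ : 0 ≤ bubble δ₁ ξ₁ x ^ p := rpow_nonneg (bubble_nonneg hδ₁.le ξ₁ x) p
  have h₂ : 0 ≤ bubble δ₂ ξ₂ x ^ q := rpow_nonneg (bubble_nonneg hδ₂.le ξ₂ x) q
  rcases le_or_gt η ‖x - ξ₁‖ with h | h
  · calc bubble δ₁ ξ₁ x ^ p * bubble δ₂ ξ₂ x ^ q
        ≤ (2 * √2 / η ^ 2) ^ p * δ₁ ^ p * bubble δ₂ ξ₂ x ^ q := by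
          gcongr
          exact bubble_rpow_le hδ₁ hp hη h
      _ ≤ _ := le_add_of_nonneg_left (by positivity)
  · have htri : ‖ξ₁ - ξ₂‖ ≤ ‖x - ξ₁‖ + ‖x - ξ₂‖ := by
      simpa only [norm_sub_rev ξ₁ x] using norm_sub_le_norm_sub_add_norm_sub ξ₁ x ξ₂
    calc bubble δ₁ ξ₁ x ^ p * bubble δ₂ ξ₂ x ^ q
        ≤ bubble δ₁ ξ₁ x ^ p * ((2 * √2 / η ^ 2) ^ q * δ₂ ^ q) := by
          gcongr
          exact bubble_rpow_le hδ₂ hq hη (by linarith)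
      _ = (2 * √2 / η ^ 2) ^ q * δ₂ ^ q * bubble δ₁ ξ₁ x ^ p := mul_comm _ _
      _ ≤ _ := le_add_of_nonneg_right (by positivity)

theorem bubble_interaction_estimate (Ω : Set (EuclideanSpace ℝ (Fin 4)))
    (hΩo : IsOpen Ω) (hΩb : Bornology.IsBounded Ω)
    (p q η : ℝ) (hp : 0 < p) (hq : 0 < q) (hη : 0 < η) :
    ∃ C > (0 : ℝ), ∃ δ₀ > (0 : ℝ), ∀ δ₁ δ₂ : ℝ, 0 < δ₁ → δ₁ < δ₀ → 0 < δ₂ → δ₂ < δ₀ →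
      ∀ ξ₁ ∈ Ω, ∀ ξ₂ ∈ Ω, 2 * η ≤ ‖ξ₁ - ξ₂‖ →
        2 * η ≤ Metric.infDist ξ₁ (frontier Ω) → 2 * η ≤ Metric.infDist ξ₂ (frontier Ω) →
        (∫ x in Ω, (bubble δ₁ ξ₁ x) ^ p * (bubble δ₂ ξ₂ x) ^ q) ≤
          C * (δ₂ ^ q * (∫ x in Ω, (bubble δ₁ ξ₁ x) ^ p) +
               δ₁ ^ p * (∫ x in Ω, (bubble δ₂ ξ₂ x) ^ q) + δ₁ ^ p * δ₂ ^ q) := by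
  have hint : ∀ f : EuclideanSpace ℝ (Fin 4) → ℝ, Continuous f → IntegrableOn f Ω := fun f hf =>
    (hf.continuousOn.integrableOn_compact hΩb.isCompact_closure).mono_set subset_closure
  refine ⟨(2 * √2 / η ^ 2) ^ q + (2 * √2 / η ^ 2) ^ p, by positivity, 1, one_pos, ?_⟩
  intro δ₁ δ₂ hδ₁ _ hδ₂ _ ξ₁ _ ξ₂ _ hξ _ _
  have hc₁ := continuous_bubble_rpow hδ₁ hp.le ξ₁
  have hc₂ := continuous_bubble_rpow hδ₂ hq.le ξ₂
  set A := (2 * √2 / η ^ 2) ^ q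
  set B := (2 * √2 / η ^ 2) ^ p
  have hA : 0 ≤ A := by positivity
  have hB : 0 ≤ B := by positivity
  have hI₁ : 0 ≤ ∫ x in Ω, bubble δ₁ ξ₁ x ^ p :=
    integral_nonneg fun x => rpow_nonneg (bubble_nonneg hδ₁.le ξ₁ x) p
  have hI₂ : 0 ≤ ∫ x in Ω, bubble δ₂ ξ₂ x ^ q :=
    integral_nonneg fun x => rpow_nonneg (bubble_nonneg hδ₂.le ξ₂ x) q
  calc ∫ x in Ω, bubble δ₁ ξ₁ x ^ p * bubble δ₂ ξ₂ x ^ q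
      ≤ ∫ x in Ω, (A * δ₂ ^ q * bubble δ₁ ξ₁ x ^ p + B * δ₁ ^ p * bubble δ₂ ξ₂ x ^ q) :=
        integral_mono (hint _ (hc₁.mul hc₂))
          (hint _ ((hc₁.const_mul _).add (hc₂.const_mul _)))
          (bubble_rpow_mul_bubble_rpow_le hδ₁ hδ₂ hp.le hq.le hη hξ)
    _ = A * (δ₂ ^ q * ∫ x in Ω, bubble δ₁ ξ₁ x ^ p) +
          B * (δ₁ ^ p * ∫ x in Ω, bubble δ₂ ξ₂ x ^ q) := by
        rw [integral_add (hint _ (hc₁.const_mul _)) (hint _ (hc₂.const_mul _)),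
          integral_const_mul, integral_const_mul, mul_assoc, mul_assoc]
    _ ≤ _ := by
        have h₁ : 0 ≤ δ₂ ^ q * ∫ x in Ω, bubble δ₁ ξ₁ x ^ p := by positivity
        have h₂ : 0 ≤ δ₁ ^ p * ∫ x in Ω, bubble δ₂ ξ₂ x ^ q := by positivity
        have h₃ : 0 ≤ δ₁ ^ p * δ₂ ^ q := by positivity
        nlinarith [mul_nonneg hA h₂, mul_nonneg hA h₃, mul_nonneg hB h₁, mul_nonneg hB h₃]
end

section
/- Let Ω ⊂ ℝ⁴ be a bounded open set and η > 0. Then there exist constants C > 0 and δ₀ ∈ (0,1) such that for all δ₁, δ₂ ∈ (0, δ₀) and all ξ₁, ξ₂ ∈ Ω with |ξ₁ − ξ₂| ≥ η, one has ∫_Ω U_{δ₁,ξ₁}(x)² U_{δ₂,ξ₂}(x)² dx ≤ C δ₁² δ₂² (1 + |ln(δ₁ δ₂)|). -/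
open MeasureTheory Real

lemma integral_mul_inv_sq_add_sq {δ R : ℝ} (hδ : 0 < δ) :
    ∫ r in (0 : ℝ)..R, r * (δ ^ 2 + r ^ 2)⁻¹ =
      (1 / 2) * Real.log (δ ^ 2 + R ^ 2) - (1 / 2) * Real.log (δ ^ 2) := by
  have hpos : ∀ r : ℝ, δ ^ 2 + r ^ 2 ≠ 0 := fun r => by positivity
  have hderiv : ∀ r ∈ Set.uIcc (0 : ℝ) R, HasDerivAt
      (fun r : ℝ => (1 / 2) * Real.log (δ ^ 2 + r ^ 2)) (r * (δ ^ 2 + r ^ 2)⁻¹) r := by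
    intro r _
    refine ((((hasDerivAt_pow 2 r).const_add (δ ^ 2)).log (hpos r)).const_mul
      (1 / 2)).congr_deriv ?_
    norm_num
    ring
  have hcont : Continuous fun r : ℝ => r * (δ ^ 2 + r ^ 2)⁻¹ := by
    fun_prop (disch := exact hpos _)
  rw [intervalIntegral.integral_eq_sub_of_hasDerivAt hderiv (hcont.intervalIntegrable _ _)]
  simp

lemma integral_mul_inv_sq_add_sq_le {δ R : ℝ} (hδ : 0 < δ) (hδ1 : δ < 1) :
    ∫ r in (0 : ℝ)..R, r * (δ ^ 2 + r ^ 2)⁻¹ ≤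
      (1 / 2) * Real.log (1 + R ^ 2) + |Real.log δ| := by
  rw [integral_mul_inv_sq_add_sq hδ, Real.log_pow]
  have h1 : Real.log (δ ^ 2 + R ^ 2) ≤ Real.log (1 + R ^ 2) :=
    Real.log_le_log (by positivity) (by nlinarith)
  have h2 := neg_abs_le (Real.log δ)
  push_cast
  linarith

lemma continuous_inv_sq_add_norm_sq_sq {δ : ℝ} (hδ : 0 < δ) (ξ : EuclideanSpace ℝ (Fin 4)) :
    Continuous fun x : EuclideanSpace ℝ (Fin 4) => ((δ ^ 2 + ‖x - ξ‖ ^ 2) ^ 2)⁻¹ := by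
  have hpos : ∀ x : EuclideanSpace ℝ (Fin 4), (δ ^ 2 + ‖x - ξ‖ ^ 2) ^ 2 ≠ 0 := fun x => by
    positivity
  fun_prop (disch := exact hpos _)

lemma setIntegral_closedBall_inv_sq_add_norm_sq_sq_le {δ R : ℝ} (hδ : 0 < δ) (hδ1 : δ < 1)
    (hR : 0 ≤ R) (ξ : EuclideanSpace ℝ (Fin 4)) :
    ∫ x in Metric.closedBall ξ R, ((δ ^ 2 + ‖x - ξ‖ ^ 2) ^ 2)⁻¹ ≤
      4 * volume.real (Metric.ball (0 : EuclideanSpace ℝ (Fin 4)) 1) *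
        ((1 / 2) * Real.log (1 + R ^ 2) + |Real.log δ|) := by
  set f : ℝ → ℝ := (Set.Iic R).indicator fun r => ((δ ^ 2 + r ^ 2) ^ 2)⁻¹ with hf
  have h1 : ∫ x in Metric.closedBall ξ R, ((δ ^ 2 + ‖x - ξ‖ ^ 2) ^ 2)⁻¹ =
      ∫ x : EuclideanSpace ℝ (Fin 4), f ‖x‖ := by
    rw [← integral_indicator Metric.isClosed_closedBall.measurableSet,
      ← integral_sub_right_eq_self (fun x : EuclideanSpace ℝ (Fin 4) => f ‖x‖) ξ]
    congr 1
  have h2 : ∫ r in Set.Ioi (0 : ℝ), r ^ 3 * f r =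
      ∫ r in (0 : ℝ)..R, r ^ 3 * ((δ ^ 2 + r ^ 2) ^ 2)⁻¹ := by
    rw [intervalIntegral.integral_of_le hR, ← Set.Ioi_inter_Iic,
      ← setIntegral_indicator measurableSet_Iic]
    simp [hf, Set.indicator_apply]
  have h3 : ∫ r in (0 : ℝ)..R, r ^ 3 * ((δ ^ 2 + r ^ 2) ^ 2)⁻¹ ≤
      ∫ r in (0 : ℝ)..R, r * (δ ^ 2 + r ^ 2)⁻¹ := by
    have hpos : ∀ r : ℝ, δ ^ 2 + r ^ 2 ≠ 0 := fun r => by positivity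
    have hpos' : ∀ r : ℝ, (δ ^ 2 + r ^ 2) ^ 2 ≠ 0 := fun r => by positivity
    refine intervalIntegral.integral_mono_on hR
      (Continuous.intervalIntegrable (by fun_prop (disch := exact hpos' _)) _ _)
      (Continuous.intervalIntegrable (by fun_prop (disch := exact hpos _)) _ _) ?_
    intro r hr
    have hr0 := hr.1
    rw [← div_eq_mul_inv, ← div_eq_mul_inv, div_le_div_iff₀ (by positivity) (by positivity)]
    have : 0 ≤ r * (δ ^ 2 + r ^ 2) * δ ^ 2 := by positivity
    nlinarith
  rw [h1, integral_fun_norm_addHaar volume f]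
  simp only [finrank_euclideanSpace, Fintype.card_fin, nsmul_eq_mul, smul_eq_mul, Nat.reduceSub]
  rw [h2]
  push_cast
  rw [← mul_assoc]
  exact mul_le_mul_of_nonneg_left (h3.trans (integral_mul_inv_sq_add_sq_le hδ hδ1)) (by positivity)

lemma quarter_sq_le_or_of_le_norm_sub {E : Type*} [NormedAddCommGroup E] {η : ℝ} (hη : 0 < η)
    {x ξ₁ ξ₂ : E} (h : η ≤ ‖ξ₁ - ξ₂‖) :
    η ^ 2 / 4 ≤ ‖x - ξ₁‖ ^ 2 ∨ η ^ 2 / 4 ≤ ‖x - ξ₂‖ ^ 2 := by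
  have htri : ‖ξ₁ - ξ₂‖ ≤ ‖x - ξ₁‖ + ‖x - ξ₂‖ := by
    have := norm_sub_le (x - ξ₂) (x - ξ₁)
    rw [sub_sub_sub_cancel_left] at this
    linarith
  rcases le_total (η / 2) ‖x - ξ₁‖ with h1 | h1
  · left; nlinarith
  · right; nlinarith

lemma inv_sq_mul_inv_sq_le {a b m : ℝ} (ha : 0 < a) (hb : 0 < b) (hm : 0 < m)
    (h : m ≤ a ∨ m ≤ b) :
    (a ^ 2)⁻¹ * (b ^ 2)⁻¹ ≤ (m ^ 2)⁻¹ * ((a ^ 2)⁻¹ + (b ^ 2)⁻¹) := by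
  have ha' : 0 < (a ^ 2)⁻¹ := by positivity
  have hb' : 0 < (b ^ 2)⁻¹ := by positivity
  have hm' : 0 < (m ^ 2)⁻¹ := by positivity
  rcases h with h | h
  · have : (a ^ 2)⁻¹ ≤ (m ^ 2)⁻¹ := by gcongr
    nlinarith
  · have : (b ^ 2)⁻¹ ≤ (m ^ 2)⁻¹ := by gcongr
    nlinarith

lemma bubble_sq (δ : ℝ) (ξ x : EuclideanSpace ℝ (Fin 4)) :
    bubble δ ξ x ^ 2 = 8 * δ ^ 2 * ((δ ^ 2 + ‖x - ξ‖ ^ 2) ^ 2)⁻¹ := by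
  rw [bubble, div_pow, mul_pow, mul_pow, Real.sq_sqrt (by norm_num), div_eq_mul_inv]
  norm_num

lemma bubble_sq_mul_bubble_sq_le {δ₁ δ₂ η : ℝ} (hδ₁ : 0 < δ₁) (hδ₂ : 0 < δ₂) (hη : 0 < η)
    {ξ₁ ξ₂ : EuclideanSpace ℝ (Fin 4)} (h : η ≤ ‖ξ₁ - ξ₂‖) (x : EuclideanSpace ℝ (Fin 4)) :
    bubble δ₁ ξ₁ x ^ 2 * bubble δ₂ ξ₂ x ^ 2 ≤
      64 * δ₁ ^ 2 * δ₂ ^ 2 * ((η ^ 2 / 4) ^ 2)⁻¹ *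
        (((δ₁ ^ 2 + ‖x - ξ₁‖ ^ 2) ^ 2)⁻¹ + ((δ₂ ^ 2 + ‖x - ξ₂‖ ^ 2) ^ 2)⁻¹) := by
  have key := inv_sq_mul_inv_sq_le (a := δ₁ ^ 2 + ‖x - ξ₁‖ ^ 2) (b := δ₂ ^ 2 + ‖x - ξ₂‖ ^ 2)
    (m := η ^ 2 / 4) (by positivity) (by positivity) (by positivity)
    ((quarter_sq_le_or_of_le_norm_sub hη h).imp
      (fun h => h.trans (le_add_of_nonneg_left (sq_nonneg δ₁)))
      (fun h => h.trans (le_add_of_nonneg_left (sq_nonneg δ₂))))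
  rw [bubble_sq, bubble_sq]
  have := mul_le_mul_of_nonneg_left key (show 0 ≤ 64 * δ₁ ^ 2 * δ₂ ^ 2 by positivity)
  linarith

theorem bubble_squared_interaction_log_estimate (Ω : Set (EuclideanSpace ℝ (Fin 4)))
    (hΩo : IsOpen Ω) (hΩb : Bornology.IsBounded Ω) (η : ℝ) (hη : 0 < η) :
    ∃ C > (0 : ℝ), ∃ δ₀ : ℝ, 0 < δ₀ ∧ δ₀ < 1 ∧
      ∀ δ₁ δ₂ : ℝ, 0 < δ₁ → δ₁ < δ₀ → 0 < δ₂ → δ₂ < δ₀ →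
      ∀ ξ₁ ∈ Ω, ∀ ξ₂ ∈ Ω, η ≤ ‖ξ₁ - ξ₂‖ →
        (∫ x in Ω, (bubble δ₁ ξ₁ x) ^ 2 * (bubble δ₂ ξ₂ x) ^ 2) ≤
          C * δ₁ ^ 2 * δ₂ ^ 2 * (1 + |Real.log (δ₁ * δ₂)|) := by
  set R := Metric.diam Ω
  set v := volume.real (Metric.ball (0 : EuclideanSpace ℝ (Fin 4)) 1)
  set L := (1 / 2) * Real.log (1 + R ^ 2)
  have hv : 0 < v := ENNReal.toReal_pos (Metric.measure_ball_pos _ _ one_pos).ne'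
    measure_ball_lt_top.ne
  have hL : 0 ≤ L := mul_nonneg (by norm_num) (Real.log_nonneg (by nlinarith [sq_nonneg R]))
  have hsub : ∀ ξ ∈ Ω, Ω ⊆ Metric.closedBall ξ R := fun ξ hξ x hx =>
    Metric.dist_le_diam_of_mem hΩb hx hξ
  have hint : ∀ δ : ℝ, 0 < δ → ∀ ξ ∈ Ω, IntegrableOn
      (fun x => ((δ ^ 2 + ‖x - ξ‖ ^ 2) ^ 2)⁻¹) (Metric.closedBall ξ R) := fun δ hδ ξ _ =>
    (continuous_inv_sq_add_norm_sq_sq hδ ξ).continuousOn.integrableOn_compact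
      (isCompact_closedBall _ _)
  have hbound : ∀ δ : ℝ, 0 < δ → δ < 1 → ∀ ξ ∈ Ω,
      ∫ x in Ω, ((δ ^ 2 + ‖x - ξ‖ ^ 2) ^ 2)⁻¹ ≤ 4 * v * (L + |Real.log δ|) :=
    fun δ hδ hδ1 ξ hξ =>
      (setIntegral_mono_set (hint δ hδ ξ hξ) (.of_forall fun x => by positivity)
        (hsub ξ hξ).eventuallyLE).trans
      (setIntegral_closedBall_inv_sq_add_norm_sq_sq_le hδ hδ1 Metric.diam_nonneg ξ)
  refine ⟨64 * ((η ^ 2 / 4) ^ 2)⁻¹ * (4 * v * (2 * L + 1)), by positivity, 1 / 2, by norm_num,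
    by norm_num, ?_⟩
  intro δ₁ δ₂ hδ₁ hδ₁' hδ₂ hδ₂' ξ₁ hξ₁ ξ₂ hξ₂ hξ
  have hi₁ := (hint δ₁ hδ₁ ξ₁ hξ₁).mono_set (hsub ξ₁ hξ₁)
  have hi₂ := (hint δ₂ hδ₂ ξ₂ hξ₂).mono_set (hsub ξ₂ hξ₂)
  have hlog : |Real.log (δ₁ * δ₂)| = |Real.log δ₁| + |Real.log δ₂| := by
    have h1 : Real.log δ₁ ≤ 0 := Real.log_nonpos hδ₁.le (by linarith)
    have h2 : Real.log δ₂ ≤ 0 := Real.log_nonpos hδ₂.le (by linarith)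
    rw [Real.log_mul hδ₁.ne' hδ₂.ne', abs_of_nonpos h1, abs_of_nonpos h2,
      abs_of_nonpos (by linarith)]
    ring
  have hsum : 4 * v * (L + |Real.log δ₁|) + 4 * v * (L + |Real.log δ₂|) ≤
      4 * v * (2 * L + 1) * (1 + |Real.log (δ₁ * δ₂)|) := by
    have h0 : 0 ≤ v * (L * |Real.log (δ₁ * δ₂)|) := by positivity
    rw [hlog] at h0 ⊢
    nlinarith
  calc ∫ x in Ω, (bubble δ₁ ξ₁ x) ^ 2 * (bubble δ₂ ξ₂ x) ^ 2
      ≤ ∫ x in Ω, 64 * δ₁ ^ 2 * δ₂ ^ 2 * ((η ^ 2 / 4) ^ 2)⁻¹ *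
        (((δ₁ ^ 2 + ‖x - ξ₁‖ ^ 2) ^ 2)⁻¹ + ((δ₂ ^ 2 + ‖x - ξ₂‖ ^ 2) ^ 2)⁻¹) :=
        integral_mono_of_nonneg (.of_forall fun x => by positivity)
          ((hi₁.add hi₂).const_mul _)
          (.of_forall fun x => bubble_sq_mul_bubble_sq_le hδ₁ hδ₂ hη hξ x)
    _ = 64 * δ₁ ^ 2 * δ₂ ^ 2 * ((η ^ 2 / 4) ^ 2)⁻¹ *
        ((∫ x in Ω, ((δ₁ ^ 2 + ‖x - ξ₁‖ ^ 2) ^ 2)⁻¹) +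
          ∫ x in Ω, ((δ₂ ^ 2 + ‖x - ξ₂‖ ^ 2) ^ 2)⁻¹) := by
        rw [integral_const_mul, integral_add hi₁ hi₂]
    _ ≤ 64 * δ₁ ^ 2 * δ₂ ^ 2 * ((η ^ 2 / 4) ^ 2)⁻¹ *
        (4 * v * (2 * L + 1) * (1 + |Real.log (δ₁ * δ₂)|)) := by
        gcongr
        exact (add_le_add (hbound δ₁ hδ₁ (by linarith) ξ₁ hξ₁)
          (hbound δ₂ hδ₂ (by linarith) ξ₂ hξ₂)).trans hsum
    _ = _ := by ring
end

section
/- Let F : ℝ → ℝ be defined by F(s) = (s⁺)⁴/4, where s⁺ = max(s,0), so that F'(s) = (s⁺)³ and F''(s) = 3(s⁺)². Then there exists a constant c > 0 such that for every a, b ∈ ℝ one has |F'(a + b) − F'(a) − F''(a)·b| ≤ c (|a| b² + |b|³). -/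
/-- `F'(s) = (s⁺)³` for `F(s) = (s⁺)⁴/4`, where `s⁺ = max s 0`. -/
noncomputable def Fq' (s : ℝ) : ℝ := (max s 0) ^ 3

/-- `F''(s) = 3(s⁺)²`. -/
noncomputable def Fq'' (s : ℝ) : ℝ := 3 * (max s 0) ^ 2

theorem Fq'_taylor_estimate :
    ∃ c > (0 : ℝ), ∀ a b : ℝ,
      |Fq' (a + b) - Fq' a - Fq'' a * b| ≤ c * (|a| * b ^ 2 + |b| ^ 3) := by
  refine ⟨3, by norm_num, fun a b => ?_⟩
  unfold Fq' Fq''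
  rcases le_total 0 a with ha | ha <;> rcases le_total 0 (a + b) with hab | hab
  · rw [max_eq_left ha, max_eq_left hab, abs_of_nonneg ha]
    have h : (a + b) ^ 3 - a ^ 3 - 3 * a ^ 2 * b = 3 * (a * b ^ 2) + b ^ 3 := by ring
    rw [h]
    have h₁ := abs_add_le (3 * (a * b ^ 2)) (b ^ 3)
    rw [abs_of_nonneg (show 0 ≤ 3 * (a * b ^ 2) by positivity), abs_pow] at h₁
    have h₂ : 0 ≤ |b| ^ 3 := by positivity
    linarith
  · rw [max_eq_left ha, max_eq_right hab, abs_of_nonneg ha]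
    have hb : a ≤ -b := by linarith
    have h₁ : a * a * (-b) ≤ a * (-b) * (-b) := by
      gcongr
      linarith
    have h₂ : a ^ 2 * a ≤ a ^ 2 * (-b) := by gcongr
    have h₃ : 0 ≤ |b| ^ 3 := by positivity
    have h₄ : 0 ≤ a ^ 3 := by positivity
    have h₅ : 0 ≤ a * b ^ 2 := by positivity
    rw [abs_le]
    constructor <;> nlinarith
  · rw [max_eq_right ha, max_eq_left hab]
    have hb : 0 ≤ b := by linarith
    have h₁ : (a + b) ^ 3 ≤ b ^ 3 := by
      gcongr
      linarith
    have h₂ : 0 ≤ (a + b) ^ 3 := by positivity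
    have h₃ : 0 ≤ |a| * b ^ 2 := by positivity
    have h₄ : 0 ≤ b ^ 3 := by positivity
    rw [abs_of_nonneg hb, abs_le]
    constructor <;> nlinarith
  · rw [max_eq_right ha, max_eq_right hab]
    norm_num
    positivity
end
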